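/- Suppose for every smooth f compactly supported in an open interval I of length τ₀ the bound ∫ ρ f² dτ ≥ −∫ [((1−2ξ)/(n−2)) m² f² + 2ξ (f')²] φ² dτ holds, where ρ, φ are continuous on I. Then sup_{I} ρ ≥ −[((1−2ξ)/(n−2)) m² + 2ξπ²/τ₀²] · sup_I φ². -/

import Mathlib

open MeasureTheory Real

lemma aux_h (δ : ℝ) (hδ : 0 < δ) : ∃ h T : ℝ → ℝ, ContDiff ℝ (⊤ : ℕ∞) h ∧
    (∀ s, HasDerivAt h (T s) s) ∧ (∀ s, 0 ≤ T s ∧ T s ≤ 1) ∧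
    (∀ s, s ≤ δ → h s = 0) ∧ (∀ s, 2 * δ ≤ s → s - 2 * δ ≤ h s) := by
  set T : ℝ → ℝ := fun t => Real.smoothTransition ((t - δ) / δ) with hT
  have hTs : ContDiff ℝ (⊤ : ℕ∞) T := by
    apply Real.smoothTransition.contDiff.comp
    fun_prop
  have hTc : Continuous T := hTs.continuous
  have hd : ∀ s, HasDerivAt (fun s => ∫ t in δ..s, T t) (T s) s := fun s =>
    intervalIntegral.integral_hasDerivAt_right (hTc.intervalIntegrable _ _)
      hTc.stronglyMeasurable.stronglyMeasurableAtFilter hTc.continuousAt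
  have hT0 : ∀ s, s ≤ δ → T s = 0 := fun s hs =>
    Real.smoothTransition.zero_of_nonpos (div_nonpos_of_nonpos_of_nonneg (by linarith) hδ.le)
  have hT1 : ∀ s, 2 * δ ≤ s → T s = 1 := fun s hs =>
    Real.smoothTransition.one_of_one_le (by rw [le_div_iff₀ hδ]; linarith)
  refine ⟨fun s => ∫ t in δ..s, T t, T, ?_, hd,
    fun s => ⟨Real.smoothTransition.nonneg _, Real.smoothTransition.le_one _⟩, ?_, ?_⟩
  · rw [contDiff_infty_iff_deriv]
    refine ⟨fun s => (hd s).differentiableAt, ?_⟩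
    have : deriv (fun s => ∫ t in δ..s, T t) = T := funext fun s => (hd s).deriv
    rw [this]; exact hTs
  · intro s hs
    have : ∫ t in δ..s, T t = ∫ t in δ..s, (0:ℝ) := by
      apply intervalIntegral.integral_congr
      intro t ht
      rw [Set.uIcc_of_ge hs] at ht
      exact hT0 t ht.2
    simpa using this
  · intro s hs
    have h1 : ∫ t in (2*δ)..s, T t = ∫ t in (2*δ)..s, (1:ℝ) := by
      apply intervalIntegral.integral_congr
      intro t ht
      rw [Set.uIcc_of_le hs] at ht
      exact hT1 t ht.1
    have h2 : 0 ≤ ∫ t in δ..(2*δ), T t :=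
      intervalIntegral.integral_nonneg (by linarith) fun t _ => Real.smoothTransition.nonneg _
    have h3 := intervalIntegral.integral_add_adjacent_intervals
      (hTc.intervalIntegrable (μ := volume) δ (2*δ)) (hTc.intervalIntegrable (2*δ) s)
    simp at h1
    show s - 2 * δ ≤ ∫ t in δ..s, T t
    linarith

lemma aux_sin (a τ : ℝ) (hτ : 0 < τ) :
    ∫ x in a..(a+τ), sin (π / τ * (x - a)) ^ 2 = τ / 2 := by
  have h1 := intervalIntegral.integral_comp_sub_right
    (a := a) (b := a + τ) (fun y => sin (π / τ * y) ^ 2) a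
  have h2 := intervalIntegral.integral_comp_mul_left (a := 0) (b := τ) (fun y => sin y ^ 2)
    (c := π / τ) (by positivity)
  simp only [sub_self, add_sub_cancel_left] at h1
  rw [h1, h2, mul_zero, div_mul_cancel₀ _ hτ.ne', integral_sin_sq]
  simp; field_simp

lemma aux_cos (a τ : ℝ) (hτ : 0 < τ) :
    ∫ x in a..(a+τ), (cos (π / τ * (x - a)) * (π / τ)) ^ 2 = π ^ 2 / τ ^ 2 * (τ / 2) := by
  have h1 := intervalIntegral.integral_comp_sub_right
    (a := a) (b := a + τ) (fun y => (cos (π / τ * y) * (π / τ)) ^ 2) a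
  have h2 := intervalIntegral.integral_comp_mul_left (a := 0) (b := τ)
    (fun y => (cos y * (π / τ)) ^ 2) (c := π / τ) (by positivity)
  simp only [sub_self, add_sub_cancel_left] at h1
  rw [h1, h2, mul_zero, div_mul_cancel₀ _ hτ.ne']
  simp only [mul_pow]
  rw [intervalIntegral.integral_mul_const, integral_cos_sq]
  simp; field_simp

lemma aux_f (a τ δ : ℝ) (hτ : 0 < τ) (hδ : 0 < δ) :
    ∃ f : ℝ → ℝ, ContDiff ℝ (⊤ : ℕ∞) f ∧ HasCompactSupport f ∧
      tsupport f ⊆ Set.Ioo a (a + τ) ∧ τ / 2 - 4 * δ * τ ≤ ∫ x, f x ^ 2 ∧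
      ∫ x, (deriv f x) ^ 2 ≤ π ^ 2 / τ ^ 2 * (τ / 2) := by
  obtain ⟨h, T, hh, hd, hT, h0, h2⟩ := aux_h δ hδ
  set s : ℝ → ℝ := fun x => sin (π / τ * (x - a)) with hs
  have hsc : ContDiff ℝ (⊤ : ℕ∞) s := by fun_prop
  have hsd : ∀ x, HasDerivAt s (cos (π / τ * (x - a)) * (π / τ)) x := by
    intro x
    have := (((hasDerivAt_id x).sub_const a).const_mul (π / τ)).sin
    simpa using this
  set f : ℝ → ℝ := (Set.Ioo a (a + τ)).indicator (fun x => h (s x)) with hf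
  set K : Set ℝ := Set.Icc a (a + τ) ∩ s ⁻¹' Set.Ici δ with hK
  have hKc : IsCompact K :=
    isCompact_Icc.inter_right (isClosed_Ici.preimage hsc.continuous)
  have hKI : K ⊆ Set.Ioo a (a + τ) := by
    rintro x ⟨⟨hx1, hx2⟩, hx3⟩
    have hx3 : δ ≤ s x := hx3
    refine ⟨lt_of_le_of_ne hx1 ?_, lt_of_le_of_ne hx2 ?_⟩
    · rintro rfl
      simp [hs] at hx3; linarith
    · rintro rfl
      simp [hs, div_mul_cancel₀ _ hτ.ne'] at hx3; linarith
  have hfK : ∀ x, x ∉ K → f x = 0 := by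
    intro x hx
    by_cases hxI : x ∈ Set.Ioo a (a + τ)
    · rw [hf, Set.indicator_of_mem hxI]
      apply h0
      by_contra hc
      exact hx ⟨Set.Ioo_subset_Icc_self hxI, (not_le.1 hc).le⟩
    · exact Set.indicator_of_notMem hxI _
  have hts : tsupport f ⊆ K :=
    closure_minimal (fun x hx => by_contra fun hc => hx (hfK x hc)) hKc.isClosed
  have hloc : ∀ x ∈ Set.Ioo a (a + τ), f =ᶠ[nhds x] (fun x => h (s x)) := by
    intro x hx
    filter_upwards [isOpen_Ioo.mem_nhds hx] with y hy
    exact Set.indicator_of_mem hy _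
  have hloc0 : ∀ x, x ∉ Set.Ioo a (a + τ) → f =ᶠ[nhds x] (fun _ => 0) := by
    intro x hx
    filter_upwards [hKc.isClosed.isOpen_compl.mem_nhds (fun hc => hx (hKI hc))] with y hy
    exact hfK y hy
  have hfs : ContDiff ℝ (⊤ : ℕ∞) f := by
    rw [contDiff_iff_contDiffAt]
    intro x
    by_cases hxI : x ∈ Set.Ioo a (a + τ)
    · exact (hh.comp hsc).contDiffAt.congr_of_eventuallyEq (hloc x hxI)
    · exact contDiffAt_const.congr_of_eventuallyEq (hloc0 x hxI)
  have hcs : HasCompactSupport f := hKc.of_isClosed_subset (isClosed_tsupport _) hts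
  have hdI : ∀ x ∈ Set.Ioo a (a + τ), deriv f x = T (s x) * (cos (π / τ * (x - a)) * (π / τ)) :=
    fun x hx => ((hloc x hx).deriv_eq).trans ((hd (s x)).comp x (hsd x)).deriv
  have hdO : ∀ x, x ∉ Set.Ioo a (a + τ) → deriv f x = 0 :=
    fun x hx => ((hloc0 x hx).deriv_eq).trans (by simp)
  have hdc : Continuous (deriv f) := hfs.continuous_deriv (by simp)
  have hle : a ≤ a + τ := by linarith
  have e1 : ∫ x, f x ^ 2 = ∫ x in a..(a+τ), f x ^ 2 := by
    rw [intervalIntegral.integral_of_le hle, integral_Ioc_eq_integral_Ioo]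
    symm
    apply setIntegral_eq_integral_of_forall_compl_eq_zero
    intro x hx
    simp [hf, Set.indicator_of_notMem hx]
  have e2 : ∫ x, (deriv f x) ^ 2 = ∫ x in a..(a+τ), (deriv f x) ^ 2 := by
    rw [intervalIntegral.integral_of_le hle, integral_Ioc_eq_integral_Ioo]
    symm
    apply setIntegral_eq_integral_of_forall_compl_eq_zero
    intro x hx
    simp [hdO x hx]
  refine ⟨f, hfs, hcs, hts.trans hKI, ?_, ?_⟩
  · have e3 : ∫ x in a..(a+τ), (s x ^ 2 - 4 * δ) = τ / 2 - 4 * δ * τ := by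
      rw [intervalIntegral.integral_sub, aux_sin a τ hτ]
      · simp; ring
      · exact (hsc.continuous.pow 2).intervalIntegrable _ _
      · exact continuous_const.intervalIntegrable _ _
    rw [e1, ← e3]
    apply intervalIntegral.integral_mono_on_of_le_Ioo hle
    · exact ((hsc.continuous.pow 2).sub continuous_const).intervalIntegrable _ _
    · exact (hfs.continuous.pow 2).intervalIntegrable _ _
    · intro x hx
      rw [hf, Set.indicator_of_mem hx]
      have hs1 : s x ≤ 1 := sin_le_one _
      have hs0 : 0 ≤ s x := by
        apply sin_nonneg_of_nonneg_of_le_pi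
        · have := hx.1
          have : 0 ≤ x - a := by linarith
          positivity
        · have := hx.2
          rw [div_mul_eq_mul_div, div_le_iff₀ hτ]
          gcongr; linarith
      by_cases hc : 2 * δ ≤ s x
      · have := h2 _ hc
        nlinarith
      · nlinarith [sq_nonneg (h (s x))]
  · rw [e2, ← aux_cos a τ hτ]
    apply intervalIntegral.integral_mono_on_of_le_Ioo hle
    · exact (hdc.pow 2).intervalIntegrable _ _
    · apply Continuous.intervalIntegrable; fun_prop
    · intro x hx
      rw [hdI x hx, mul_pow]
      have := hT (s x)
      have h3 : T (s x) ^ 2 ≤ 1 := by nlinarith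
      exact mul_le_of_le_one_left (sq_nonneg _) h3

lemma aux_int (U : Set ℝ) (hU : IsOpen U) (g k : ℝ → ℝ) (hg : ContinuousOn g U)
    (hk : Continuous k) (hcs : HasCompactSupport k) (hts : tsupport k ⊆ U) :
    Integrable (fun x => g x * k x) := by
  apply Continuous.integrable_of_hasCompactSupport
  · rw [continuous_iff_continuousAt]
    intro x
    by_cases hx : x ∈ U
    · exact (hg.continuousAt (hU.mem_nhds hx)).mul hk.continuousAt
    · have h0 : k =ᶠ[nhds x] 0 := notMem_tsupport_iff_eventuallyEq.1 fun hc => hx (hts hc)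
      have : (fun x => g x * k x) =ᶠ[nhds x] fun _ => (0:ℝ) := by
        filter_upwards [h0] with y hy
        simp [hy]
      exact continuousAt_const.congr this.symm
  · exact hcs.mul_left


/-- Eq. (26): sup_I ρ ≥ −[((1−2ξ)/(n−2)) m² + 2ξπ²/τ₀²] · sup_I φ². -/
theorem stmt_5 (n : ℕ) (hn : 3 ≤ n) (m ξ τ₀ a : ℝ)
    (hm : 0 ≤ m) (hξ0 : 0 ≤ ξ) (hξ : ξ ≤ 1 / 2) (hτ₀ : 0 < τ₀)
    (ρ φ : ℝ → ℝ)
    (hρ : ContinuousOn ρ (Set.Ioo a (a + τ₀)))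
    (hφ : ContinuousOn φ (Set.Ioo a (a + τ₀)))
    (hρbdd : BddAbove (ρ '' Set.Ioo a (a + τ₀)))
    (hφbdd : BddAbove ((fun τ => φ τ ^ 2) '' Set.Ioo a (a + τ₀)))
    (hbound : ∀ f : ℝ → ℝ, ContDiff ℝ (⊤ : ℕ∞) f → HasCompactSupport f →
      tsupport f ⊆ Set.Ioo a (a + τ₀) →
      ∫ τ : ℝ, ρ τ * f τ ^ 2 ≥
        -∫ τ : ℝ, (((1 - 2 * ξ) / ((n : ℝ) - 2)) * m ^ 2 * f τ ^ 2
          + 2 * ξ * (deriv f τ) ^ 2) * φ τ ^ 2) :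
    sSup (ρ '' Set.Ioo a (a + τ₀)) ≥
      -(((1 - 2 * ξ) / ((n : ℝ) - 2)) * m ^ 2 + 2 * ξ * π ^ 2 / τ₀ ^ 2)
        * sSup ((fun τ => φ τ ^ 2) '' Set.Ioo a (a + τ₀)) := by

  set U := Set.Ioo a (a + τ₀) with hU
  set S := sSup (ρ '' U) with hS
  set M := sSup ((fun τ => φ τ ^ 2) '' U) with hM
  set c := ((1 - 2 * ξ) / ((n : ℝ) - 2)) * m ^ 2 with hc
  have hn' : (3:ℝ) ≤ n := by exact_mod_cast hn
  have hc0 : 0 ≤ c := by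
    have h1 : 0 ≤ 1 - 2 * ξ := by linarith
    have h2 : 0 ≤ (n:ℝ) - 2 := by linarith
    positivity
  have hM0 : 0 ≤ M := Real.sSup_nonneg (by rintro _ ⟨x, _, rfl⟩; positivity)
  have hSle : ∀ x ∈ U, ρ x ≤ S := fun x hx => le_csSup hρbdd ⟨x, hx, rfl⟩
  have hMle : ∀ x ∈ U, φ x ^ 2 ≤ M := fun x hx => le_csSup hφbdd ⟨x, hx, rfl⟩
  have key : ∀ δ : ℝ, 0 < δ → δ < 1 / 8 →
      -(M * (2 * ξ * (π ^ 2 / τ₀ ^ 2))) ≤ (1 - 8 * δ) * (S + M * c) := by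
    intro δ hδ hδ8
    obtain ⟨f, hf, hcs, hts, hN, hD⟩ := aux_f a τ₀ δ hτ₀ hδ
    have hb := hbound f hf hcs hts
    have hfc := hf.continuous
    have hdc : Continuous (deriv f) := hf.continuous_deriv (by simp)
    have hcs2 : HasCompactSupport (fun x => f x ^ 2) := by
      simp only [pow_two]; exact hcs.mul_left (f := f)
    have hcsd2 : HasCompactSupport (fun x => deriv f x ^ 2) := by
      simp only [pow_two]; exact hcs.deriv.mul_left (f := deriv f)
    have hts2 : tsupport (fun x => f x ^ 2) ⊆ U := by
      refine (closure_mono ?_).trans hts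
      intro x hx hx0
      exact hx (by simp [hx0])
    have hz : ∀ x, x ∉ U → f x = 0 ∧ deriv f x = 0 := by
      intro x hx
      refine ⟨image_eq_zero_of_notMem_tsupport fun h => hx (hts h), ?_⟩
      by_contra h
      exact hx (hts (support_deriv_subset h))
    have i1 : Integrable (fun x => f x ^ 2) :=
      (hfc.pow 2).integrable_of_hasCompactSupport hcs2
    have i2 : Integrable (fun x => deriv f x ^ 2) :=
      (hdc.pow 2).integrable_of_hasCompactSupport hcsd2
    have i3 : Integrable (fun x => ρ x * f x ^ 2) :=
      aux_int U isOpen_Ioo ρ _ hρ (hfc.pow 2) hcs2 hts2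
    have b1 : ∫ x, ρ x * f x ^ 2 ≤ S * ∫ x, f x ^ 2 := by
      rw [← integral_const_mul]
      apply integral_mono i3 (i1.const_mul S)
      intro x
      by_cases hx : x ∈ U
      · exact mul_le_mul_of_nonneg_right (hSle x hx) (sq_nonneg _)
      · simp [(hz x hx).1]
    have b2 : ∫ x, (c * f x ^ 2 + 2 * ξ * (deriv f x) ^ 2) * φ x ^ 2 ≤
        M * (c * (∫ x, f x ^ 2) + 2 * ξ * ∫ x, (deriv f x) ^ 2) := by
      rw [← integral_const_mul, ← integral_const_mul,
        ← integral_add (i1.const_mul c) (i2.const_mul _), ← integral_const_mul]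
      apply integral_mono_of_nonneg
      · exact Filter.Eventually.of_forall fun x => by positivity
      · exact ((i1.const_mul c).add (i2.const_mul _)).const_mul M
      · refine Filter.Eventually.of_forall fun x => ?_
        by_cases hx : x ∈ U
        · have h0 : 0 ≤ c * f x ^ 2 + 2 * ξ * deriv f x ^ 2 := by positivity
          have h1 := mul_le_mul_of_nonneg_left (hMle x hx) h0
          show (c * f x ^ 2 + 2 * ξ * deriv f x ^ 2) * φ x ^ 2 ≤
            M * (c * f x ^ 2 + 2 * ξ * deriv f x ^ 2)
          linarith
        · simp [(hz x hx).1, (hz x hx).2]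
    set N := ∫ x, f x ^ 2 with hNdef
    set D := ∫ x, (deriv f x) ^ 2 with hDdef
    have hδ1 : 0 < 1 - 8 * δ := by linarith
    have hNpos : 0 < N := by nlinarith
    have hDN : (1 - 8 * δ) * D ≤ π ^ 2 / τ₀ ^ 2 * N := by
      calc (1 - 8 * δ) * D ≤ (1 - 8 * δ) * (π ^ 2 / τ₀ ^ 2 * (τ₀ / 2)) := by gcongr
        _ = π ^ 2 / τ₀ ^ 2 * (τ₀ / 2 - 4 * δ * τ₀) := by ring
        _ ≤ _ := by gcongr
    have h1 : -(M * (2 * ξ * D)) ≤ (S + M * c) * N := by linarith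
    have h2 : (M * (2 * ξ)) * ((1 - 8 * δ) * D) ≤ (M * (2 * ξ)) * (π ^ 2 / τ₀ ^ 2 * N) := by
      gcongr
    have h3 := mul_le_mul_of_nonneg_left h1 hδ1.le
    refine le_of_mul_le_mul_right ?_ hNpos
    linarith
  set B := M * (2 * ξ * (π ^ 2 / τ₀ ^ 2)) with hB
  have hB0 : 0 ≤ B := by positivity
  have fin : -B ≤ S + M * c := by
    by_contra hcon
    push Not at hcon
    set A := S + M * c with hA
    have hA0 : 0 < -A := by linarith
    have hq : (-B - A) / (-A) * (-A) = -B - A := div_mul_cancel₀ _ hA0.ne'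
    have hq0 : 0 < (-B - A) / (-A) := div_pos (by linarith) hA0
    have hq1 : (-B - A) / (-A) ≤ 1 := (div_le_one hA0).2 (by linarith)
    have := key ((-B - A) / (-A) / 16) (by linarith) (by linarith)
    nlinarith
  have : 2 * ξ * π ^ 2 / τ₀ ^ 2 = 2 * ξ * (π ^ 2 / τ₀ ^ 2) := by ring
  rw [this]
  show _ ≤ S
  linarith
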